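/- Along the iteration q^{[t+1]}(x,y) = exp(−ω_{q^{[t]}}^{(μ,λ)}(x,y)) q^{[t]}(x,y) / Λ_{q^{[t]}}^{(μ,λ)} started from a joint distribution q^{[1]} with all components positive, the following chain holds for every t ≥ 1: F^{(μ,λ)}(q^{[t]},q^{[t]}) ≥ F^{(μ,λ)}(q^{[t]},q^{[t+1]}) = −log Λ_{q^{[t]}}^{(μ,λ)} ≥ F^{(μ,λ)}(q^{[t+1]},q^{[t+1]}) = E_{q^{[t+1]}}[ω_{q^{[t+1]}}^{(μ,λ)}(X,Y)] ≥ Ω^{(μ,λ)}(P). In particular the sequence t ↦ F^{(μ,λ)}(q^{[t]},q^{[t]}) is nonincreasing and bounded below by Ω^{(μ,λ)}(P). -/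

import Mathlib

open Real Filter

noncomputable section

def IsDist {X : Type*} [Fintype X] (P : X → ℝ) : Prop :=
  (∀ x, 0 ≤ P x) ∧ ∑ x, P x = 1

def IsJoint {X Y : Type*} [Fintype X] [Fintype Y] (q : X → Y → ℝ) : Prop :=
  (∀ x y, 0 ≤ q x y) ∧ ∑ x, ∑ y, q x y = 1

def IsCond {X Y : Type*} [Fintype X] [Fintype Y] (V : X → Y → ℝ) : Prop :=
  (∀ x y, 0 ≤ V x y) ∧ ∀ x, ∑ y, V x y = 1

def margX {X Y : Type*} [Fintype Y] (q : X → Y → ℝ) (x : X) : ℝ := ∑ y, q x y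

def margY {X Y : Type*} [Fintype X] (q : X → Y → ℝ) (y : Y) : ℝ := ∑ x, q x y

/-- conditional distribution of `X` given `Y` : `q_{X|Y}(x|y)` -/
def condXY {X Y : Type*} [Fintype X] (q : X → Y → ℝ) (x : X) (y : Y) : ℝ :=
  q x y / margY q y

/-- conditional distribution of `Y` given `X` : `q_{Y|X}(y|x)` -/
def condYX {X Y : Type*} [Fintype Y] (q : X → Y → ℝ) (x : X) (y : Y) : ℝ :=
  q x y / margX q x

/-- mutual information `I(q_X, q_{Y|X})` of a joint distribution `q` -/
def mutInfo {X Y : Type*} [Fintype X] [Fintype Y] (q : X → Y → ℝ) : ℝ :=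
  ∑ x, ∑ y, q x y * Real.log (q x y / (margX q x * margY q y))

/-- divergence `D(q_X ‖ P)` -/
def klX {X Y : Type*} [Fintype X] [Fintype Y] (q : X → Y → ℝ) (P : X → ℝ) : ℝ :=
  ∑ x, margX q x * Real.log (margX q x / P x)

/-- divergence `D(p ‖ q)` of distributions on `X` -/
def klD {X : Type*} [Fintype X] (p q : X → ℝ) : ℝ :=
  ∑ x, p x * Real.log (p x / q x)

/-- divergence `D(q ‖ p)` of joint distributions -/
def klJoint {X Y : Type*} [Fintype X] [Fintype Y] (q p : X → Y → ℝ) : ℝ :=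
  ∑ x, ∑ y, q x y * Real.log (q x y / p x y)

/-- expected distortion `E_q[d(X,Y)]` -/
def Ed {X Y : Type*} [Fintype X] [Fintype Y] (q d : X → Y → ℝ) : ℝ :=
  ∑ x, ∑ y, q x y * d x y

/-- `G(R,Δ|P)` -/
def G {X Y : Type*} [Fintype X] [Fintype Y] (P : X → ℝ) (d : X → Y → ℝ) (R Δ : ℝ) : ℝ :=
  sInf {v : ℝ | ∃ q : X → Y → ℝ, IsJoint q ∧ Ed q d ≤ Δ ∧
    v = max 0 (mutInfo q - R) + klX q P}

/-- `G^{(λ)}(R,Δ|P)` -/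
def Glam {X Y : Type*} [Fintype X] [Fintype Y] (P : X → ℝ) (d : X → Y → ℝ)
    (lam R Δ : ℝ) : ℝ :=
  sInf {v : ℝ | ∃ q : X → Y → ℝ, IsJoint q ∧ Ed q d ≤ Δ ∧
    v = lam * (mutInfo q - R) + klX q P}

/-- rate distortion function `R(Δ|P)` -/
def RD {X Y : Type*} [Fintype X] [Fintype Y] (P : X → ℝ) (d : X → Y → ℝ) (Δ : ℝ) : ℝ :=
  sInf {v : ℝ | ∃ V : X → Y → ℝ, IsCond V ∧ Ed (fun x y => P x * V x y) d ≤ Δ ∧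
    v = mutInfo (fun x y => P x * V x y)}

/-- `Ω^{(μ,λ)}(P)` -/
def OmegaF {X Y : Type*} [Fintype X] [Fintype Y] (P : X → ℝ) (d : X → Y → ℝ)
    (μ lam : ℝ) : ℝ :=
  sInf {v : ℝ | ∃ q : X → Y → ℝ, IsJoint q ∧
    v = lam * mutInfo q + klX q P + μ * Ed q d}

/-- `G^{(μ,λ)}(R,Δ|P) = Ω^{(μ,λ)}(P) − λR − μΔ` -/
def Gmulam {X Y : Type*} [Fintype X] [Fintype Y] (P : X → ℝ) (d : X → Y → ℝ)
    (μ lam R Δ : ℝ) : ℝ :=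
  OmegaF P d μ lam - lam * R - μ * Δ

/-- `ω_q^{(μ,λ)}(x,y)` -/
def omg {X Y : Type*} [Fintype X] [Fintype Y] (P : X → ℝ) (d : X → Y → ℝ)
    (μ lam : ℝ) (q : X → Y → ℝ) (x : X) (y : Y) : ℝ :=
  Real.log (margX q x ^ (1 - lam) * condXY q x y ^ lam * Real.exp (μ * d x y) / P x)

/-- `F^{(μ,λ)}(p,q) = E_q[ω_p^{(μ,λ)}(X,Y)] + D(q‖p)` -/
def Ffun {X Y : Type*} [Fintype X] [Fintype Y] (P : X → ℝ) (d : X → Y → ℝ)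
    (μ lam : ℝ) (p q : X → Y → ℝ) : ℝ :=
  (∑ x, ∑ y, q x y * omg P d μ lam p x y) + klJoint q p

/-- `Λ_p^{(μ,λ)} = E_p[exp(−ω_p^{(μ,λ)}(X,Y))]` -/
def Lam {X Y : Type*} [Fintype X] [Fintype Y] (P : X → ℝ) (d : X → Y → ℝ)
    (μ lam : ℝ) (p : X → Y → ℝ) : ℝ :=
  ∑ x, ∑ y, p x y * Real.exp (-(omg P d μ lam p x y))

/-- cutoff rate `R_cut^{(λ)}(Δ|P)` -/
def Rcut {X Y : Type*} [Fintype X] [Fintype Y] (P : X → ℝ) (d : X → Y → ℝ)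
    (lam Δ : ℝ) : ℝ :=
  sInf {v : ℝ | ∃ q : X → Y → ℝ, IsJoint q ∧ Ed q d ≤ Δ ∧
    v = mutInfo q + (1 / lam) * klX q P}

/-- Shannon entropy -/
def entropy {X : Type*} [Fintype X] (p : X → ℝ) : ℝ :=
  -∑ x, p x * Real.log (p x)

theorem sub_le_mul_log_div {a b : ℝ} (ha : 0 ≤ a) (hb : 0 ≤ b) (hab : b = 0 → a = 0) :
    a - b ≤ a * Real.log (a / b) := by
  rcases ha.eq_or_lt with rfl | ha
  · simpa using hb
  · have hb : 0 < b := hb.lt_of_ne fun h => ha.ne' (hab h.symm)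
    have h := Real.log_le_sub_one_of_pos (div_pos hb ha)
    have hlog : Real.log (a / b) = -Real.log (b / a) := by rw [← Real.log_inv, inv_div]
    have hmul : a * (b / a) = b := by field_simp
    rw [hlog]
    nlinarith [mul_le_mul_of_nonneg_left h ha.le]

/-- Gibbs inequality -/
theorem klD_nonneg {X : Type*} [Fintype X] {p q : X → ℝ} (hp : ∀ x, 0 ≤ p x)
    (hq : ∀ x, 0 ≤ q x) (hac : ∀ x, q x = 0 → p x = 0) (hsum : ∑ x, q x = ∑ x, p x) :
    0 ≤ klD p q := by
  have h := Finset.sum_le_sum fun x (_ : x ∈ Finset.univ) =>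
    sub_le_mul_log_div (hp x) (hq x) (hac x)
  rw [Finset.sum_sub_distrib, hsum, sub_self] at h
  exact h

theorem margX_nonneg {X Y : Type*} [Fintype Y] {q : X → Y → ℝ} (hq : ∀ x y, 0 ≤ q x y) (x : X) :
    0 ≤ margX q x :=
  Finset.sum_nonneg fun y _ => hq x y

theorem margY_nonneg {X Y : Type*} [Fintype X] {q : X → Y → ℝ} (hq : ∀ x y, 0 ≤ q x y) (y : Y) :
    0 ≤ margY q y :=
  Finset.sum_nonneg fun x _ => hq x y

theorem margX_pos {X Y : Type*} [Fintype Y] {q : X → Y → ℝ} (hq : ∀ x y, 0 < q x y) (x : X) (y : Y) :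
    0 < margX q x :=
  Finset.sum_pos (fun y _ => hq x y) ⟨y, Finset.mem_univ y⟩

theorem margY_pos {X Y : Type*} [Fintype X] {q : X → Y → ℝ} (hq : ∀ x y, 0 < q x y) (x : X) (y : Y) :
    0 < margY q y :=
  Finset.sum_pos (fun x _ => hq x y) ⟨x, Finset.mem_univ x⟩

section

variable {X Y : Type*} [Fintype X] [Fintype Y]

/-- Gibbs inequality for joint distributions -/
theorem klJoint_nonneg {q p : X → Y → ℝ} (hq : ∀ x y, 0 ≤ q x y) (hp : ∀ x y, 0 ≤ p x y)
    (hac : ∀ x y, p x y = 0 → q x y = 0) (hsum : ∑ x, ∑ y, p x y = ∑ x, ∑ y, q x y) :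
    0 ≤ klJoint q p := by
  have h := klD_nonneg (p := fun z : X × Y => q z.1 z.2) (q := fun z => p z.1 z.2)
    (fun z => hq _ _) (fun z => hp _ _) (fun z => hac _ _)
    (by simpa only [Fintype.sum_prod_type] using hsum)
  simpa only [klD, klJoint, Fintype.sum_prod_type] using h

theorem klJoint_self (q : X → Y → ℝ) : klJoint q q = 0 := by
  refine Finset.sum_eq_zero fun x _ => Finset.sum_eq_zero fun y _ => ?_
  by_cases h : q x y = 0
  · simp [h]
  · simp [div_self h]

theorem sum_margX (q : X → Y → ℝ) : ∑ x, margX q x = ∑ x, ∑ y, q x y := rfl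

theorem sum_margY (q : X → Y → ℝ) : ∑ y, margY q y = ∑ x, ∑ y, q x y := Finset.sum_comm

theorem sum_sum_mul_fst (q : X → Y → ℝ) (f : X → ℝ) :
    ∑ x, ∑ y, q x y * f x = ∑ x, margX q x * f x := by
  simp only [margX, Finset.sum_mul]

theorem sum_sum_mul_snd (q : X → Y → ℝ) (f : Y → ℝ) :
    ∑ x, ∑ y, q x y * f y = ∑ y, margY q y * f y := by
  rw [Finset.sum_comm]
  simp only [margY, Finset.sum_mul]

theorem mutInfo_nonneg {q : X → Y → ℝ} (hq : IsJoint q) : 0 ≤ mutInfo q := by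
  refine klJoint_nonneg (p := fun x y => margX q x * margY q y) hq.1
    (fun x y => mul_nonneg (margX_nonneg hq.1 x) (margY_nonneg hq.1 y)) (fun x y h => ?_) ?_
  · rcases mul_eq_zero.1 h with h | h
    · exact (Finset.sum_eq_zero_iff_of_nonneg fun y _ => hq.1 x y).1 h y (Finset.mem_univ y)
    · exact (Finset.sum_eq_zero_iff_of_nonneg fun x _ => hq.1 x y).1 h x (Finset.mem_univ x)
  · rw [← Fintype.sum_mul_sum, sum_margX, sum_margY, hq.2, one_mul]

theorem klX_nonneg {q : X → Y → ℝ} (hq : IsJoint q) {P : X → ℝ} (hP : IsDist P)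
    (hPpos : ∀ x, 0 < P x) : 0 ≤ klX q P :=
  klD_nonneg (p := margX q) (margX_nonneg hq.1) hP.1 (fun x h => absurd h (hPpos x).ne')
    (by rw [hP.2, sum_margX, hq.2])

theorem OmegaF_le {P : X → ℝ} (hP : IsDist P) (hPpos : ∀ x, 0 < P x) {d : X → Y → ℝ}
    (hd : ∀ x y, 0 ≤ d x y) {μ lam : ℝ} (hμ : 0 ≤ μ) (hlam : 0 ≤ lam) {q : X → Y → ℝ}
    (hq : IsJoint q) : OmegaF P d μ lam ≤ lam * mutInfo q + klX q P + μ * Ed q d := by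
  refine csInf_le ⟨0, ?_⟩ ⟨q, hq, rfl⟩
  rintro _ ⟨r, hr, rfl⟩
  have hEd : 0 ≤ Ed r d :=
    Finset.sum_nonneg fun x _ => Finset.sum_nonneg fun y _ => mul_nonneg (hr.1 x y) (hd x y)
  have := mutInfo_nonneg hr
  have := klX_nonneg hr hP hPpos
  positivity

theorem klX_margX_le_klJoint {q p : X → Y → ℝ} (hq : ∀ x y, 0 < q x y)
    (hp : ∀ x y, 0 < p x y) : klX q (margX p) ≤ klJoint q p := by
  have hpos : ∀ x y, 0 < p x y * (margX q x / margX p x) := fun x y =>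
    mul_pos (hp x y) (div_pos (margX_pos hq x y) (margX_pos hp x y))
  have h := klJoint_nonneg (q := q) (p := fun x y => p x y * (margX q x / margX p x))
    (fun x y => (hq x y).le) (fun x y => (hpos x y).le) (fun x y h => absurd h (hpos x y).ne') <| by
      refine Finset.sum_congr rfl fun x _ => ?_
      rw [← Finset.sum_mul]
      change margX p x * (margX q x / margX p x) = margX q x
      rcases isEmpty_or_nonempty Y with hY | ⟨⟨y⟩⟩
      · simp [margX]
      · exact mul_div_cancel₀ _ (margX_pos hp x y).ne'
  have e : klJoint q (fun x y => p x y * (margX q x / margX p x)) =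
      klJoint q p - klX q (margX p) := by
    unfold klJoint klX
    rw [← sum_sum_mul_fst]
    simp only [← Finset.sum_sub_distrib]
    refine Finset.sum_congr rfl fun x _ => Finset.sum_congr rfl fun y _ => ?_
    rw [← mul_sub, ← div_div, Real.log_div (div_pos (hq x y) (hp x y)).ne'
      (div_pos (margX_pos hq x y) (margX_pos hp x y)).ne']
  linarith

theorem omg_eq {P : X → ℝ} (hPpos : ∀ x, 0 < P x) (d : X → Y → ℝ) (μ lam : ℝ)
    {q : X → Y → ℝ} (hq : ∀ x y, 0 < q x y) (x : X) (y : Y) :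
    omg P d μ lam q x y = (1 - lam) * Real.log (margX q x) +
      lam * (Real.log (q x y) - Real.log (margY q y)) + μ * d x y - Real.log (P x) := by
  have hX := margX_pos hq x y
  have hY := margY_pos hq x y
  have hc : 0 < condXY q x y := div_pos (hq x y) hY
  have h1 : 0 < margX q x ^ (1 - lam) := Real.rpow_pos_of_pos hX _
  have h2 : 0 < condXY q x y ^ lam := Real.rpow_pos_of_pos hc _
  rw [omg, Real.log_div (by positivity) (hPpos x).ne', Real.log_mul (by positivity) (by positivity),
    Real.log_mul h1.ne' h2.ne', Real.log_rpow hX, Real.log_rpow hc, Real.log_exp, condXY,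
    Real.log_div (hq x y).ne' hY.ne']

theorem Ffun_self (P : X → ℝ) (d : X → Y → ℝ) (μ lam : ℝ) (q : X → Y → ℝ) :
    Ffun P d μ lam q q = ∑ x, ∑ y, q x y * omg P d μ lam q x y := by
  rw [Ffun, klJoint_self, add_zero]

theorem Ffun_self_eq {P : X → ℝ} (hPpos : ∀ x, 0 < P x) (d : X → Y → ℝ) (μ lam : ℝ)
    {q : X → Y → ℝ} (hq : ∀ x y, 0 < q x y) :
    Ffun P d μ lam q q = lam * mutInfo q + klX q P + μ * Ed q d := by
  rw [Ffun_self, mutInfo, klX, ← sum_sum_mul_fst, Ed]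
  simp only [Finset.mul_sum, ← Finset.sum_add_distrib]
  refine Finset.sum_congr rfl fun x _ => Finset.sum_congr rfl fun y _ => ?_
  have hX := margX_pos hq x y
  have hY := margY_pos hq x y
  rw [omg_eq hPpos d μ lam hq, Real.log_div (hq x y).ne' (by positivity),
    Real.log_mul hX.ne' hY.ne', Real.log_div hX.ne' (hPpos x).ne']
  ring

theorem Ffun_self_le {P : X → ℝ} (hPpos : ∀ x, 0 < P x) (d : X → Y → ℝ) {μ lam : ℝ}
    (hlam0 : 0 ≤ lam) (hlam1 : lam ≤ 1) {p q : X → Y → ℝ} (hp : ∀ x y, 0 < p x y)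
    (hq : ∀ x y, 0 < q x y) (hsum : ∑ x, ∑ y, p x y = ∑ x, ∑ y, q x y) :
    Ffun P d μ lam q q ≤ Ffun P d μ lam p q := by
  have hX := klX_margX_le_klJoint hq hp
  have hY : 0 ≤ klD (margY q) (margY p) := by
    refine klD_nonneg (margY_nonneg fun x y => (hq x y).le) (margY_nonneg fun x y => (hp x y).le)
      (fun y h => ?_) (by rw [sum_margY, sum_margY, hsum])
    rcases isEmpty_or_nonempty X with hX | ⟨⟨x⟩⟩
    · simp [margY]
    · exact absurd h (margY_pos hp x y).ne'
  have e : Ffun P d μ lam p q - Ffun P d μ lam q q =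
      (1 - lam) * (klJoint q p - klX q (margX p)) + lam * klD (margY q) (margY p) := by
    rw [Ffun_self, Ffun, klJoint, klX, klD, ← sum_sum_mul_fst, ← sum_sum_mul_snd]
    simp only [Finset.mul_sum, ← Finset.sum_add_distrib, ← Finset.sum_sub_distrib]
    refine Finset.sum_congr rfl fun x _ => Finset.sum_congr rfl fun y _ => ?_
    rw [omg_eq hPpos d μ lam hp, omg_eq hPpos d μ lam hq, Real.log_div (hq x y).ne' (hp x y).ne',
      Real.log_div (margX_pos hq x y).ne' (margX_pos hp x y).ne',
      Real.log_div (margY_pos hq x y).ne' (margY_pos hp x y).ne']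
    ring
  have := mul_nonneg (sub_nonneg.2 hlam1) (sub_nonneg.2 hX)
  have := mul_nonneg hlam0 hY
  linarith

theorem Lam_pos (P : X → ℝ) (d : X → Y → ℝ) (μ lam : ℝ) {p : X → Y → ℝ} (hp : IsJoint p)
    (hpos : ∀ x y, 0 < p x y) : 0 < Lam P d μ lam p := by
  obtain ⟨x, hx, h⟩ := Finset.exists_ne_zero_of_sum_ne_zero (hp.2.trans_ne one_ne_zero)
  obtain ⟨y, hy, -⟩ := Finset.exists_ne_zero_of_sum_ne_zero h
  exact Finset.sum_pos (fun x _ => Finset.sum_pos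
    (fun y _ => mul_pos (hpos x y) (Real.exp_pos _)) ⟨y, hy⟩) ⟨x, hx⟩

/-- the step `p ↦ exp(−ω_p) p / Λ_p` of the iteration -/
def tilt (P : X → ℝ) (d : X → Y → ℝ) (μ lam : ℝ) (p : X → Y → ℝ) (x : X) (y : Y) : ℝ :=
  Real.exp (-(omg P d μ lam p x y)) * p x y / Lam P d μ lam p

theorem tilt_pos (P : X → ℝ) (d : X → Y → ℝ) (μ lam : ℝ) {p : X → Y → ℝ} (hp : IsJoint p)
    (hpos : ∀ x y, 0 < p x y) (x : X) (y : Y) : 0 < tilt P d μ lam p x y :=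
  div_pos (mul_pos (Real.exp_pos _) (hpos x y)) (Lam_pos P d μ lam hp hpos)

theorem isJoint_tilt (P : X → ℝ) (d : X → Y → ℝ) (μ lam : ℝ) {p : X → Y → ℝ} (hp : IsJoint p)
    (hpos : ∀ x y, 0 < p x y) : IsJoint (tilt P d μ lam p) := by
  refine ⟨fun x y => (tilt_pos P d μ lam hp hpos x y).le, ?_⟩
  simp only [tilt, ← Finset.sum_div, mul_comm (Real.exp _)]
  exact div_self (Lam_pos P d μ lam hp hpos).ne'

theorem Ffun_eq_klJoint_tilt (P : X → ℝ) (d : X → Y → ℝ) (μ lam : ℝ) {p q : X → Y → ℝ}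
    (hp : IsJoint p) (hpos : ∀ x y, 0 < p x y) (hq : IsJoint q) (hqpos : ∀ x y, 0 < q x y) :
    Ffun P d μ lam p q = klJoint q (tilt P d μ lam p) - Real.log (Lam P d μ lam p) := by
  have hL := Lam_pos P d μ lam hp hpos
  rw [Ffun, ← one_mul (Real.log (Lam P d μ lam p)), ← hq.2, klJoint, klJoint]
  simp only [Finset.sum_mul, ← Finset.sum_add_distrib, ← Finset.sum_sub_distrib]
  refine Finset.sum_congr rfl fun x _ => Finset.sum_congr rfl fun y _ => ?_
  rw [Real.log_div (hqpos x y).ne' (hpos x y).ne',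
    Real.log_div (hqpos x y).ne' (tilt_pos P d μ lam hp hpos x y).ne', tilt,
    Real.log_div (mul_pos (Real.exp_pos _) (hpos x y)).ne' hL.ne',
    Real.log_mul (Real.exp_pos _).ne' (hpos x y).ne', Real.log_exp]
  ring

end

/-- Proposition 1: the chain of (in)equalities along the iteration
`q^{[t+1]} = exp(−ω_{q^{[t]}}) q^{[t]} / Λ_{q^{[t]}}`; in particular
`t ↦ F^{(μ,λ)}(q^{[t]},q^{[t]})` is nonincreasing and bounded below by `Ω^{(μ,λ)}(P)`. -/
theorem stmt12 {X Y : Type*} [Fintype X] [Fintype Y]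
    (P : X → ℝ) (hP : IsDist P) (hPpos : ∀ x, 0 < P x)
    (d : X → Y → ℝ) (hd : ∀ x y, 0 ≤ d x y)
    (μ lam : ℝ) (hμ : 0 ≤ μ) (hlam0 : 0 ≤ lam) (hlam1 : lam ≤ 1)
    (qseq : ℕ → X → Y → ℝ)
    (hinit : IsJoint (qseq 1)) (hinitpos : ∀ x y, 0 < qseq 1 x y)
    (hstep : ∀ t : ℕ, 1 ≤ t → ∀ x y,
      qseq (t + 1) x y =
        Real.exp (-(omg P d μ lam (qseq t) x y)) * qseq t x y /
          Lam P d μ lam (qseq t)) :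
    ∀ t : ℕ, 1 ≤ t →
      Ffun P d μ lam (qseq t) (qseq (t + 1)) ≤ Ffun P d μ lam (qseq t) (qseq t) ∧
      Ffun P d μ lam (qseq t) (qseq (t + 1)) = -Real.log (Lam P d μ lam (qseq t)) ∧
      Ffun P d μ lam (qseq (t + 1)) (qseq (t + 1)) ≤
        -Real.log (Lam P d μ lam (qseq t)) ∧
      Ffun P d μ lam (qseq (t + 1)) (qseq (t + 1)) =
        (∑ x, ∑ y, qseq (t + 1) x y * omg P d μ lam (qseq (t + 1)) x y) ∧
      OmegaF P d μ lam ≤ Ffun P d μ lam (qseq (t + 1)) (qseq (t + 1)) ∧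
      Ffun P d μ lam (qseq (t + 1)) (qseq (t + 1)) ≤
        Ffun P d μ lam (qseq t) (qseq t) ∧
      OmegaF P d μ lam ≤ Ffun P d μ lam (qseq t) (qseq t) := by
  have hjoint : ∀ t, 1 ≤ t → IsJoint (qseq t) ∧ ∀ x y, 0 < qseq t x y := by
    intro t ht
    induction t, ht using Nat.le_induction with
    | base => exact ⟨hinit, hinitpos⟩
    | succ t ht ih =>
      rw [show qseq (t + 1) = tilt P d μ lam (qseq t) from funext₂ (hstep t ht)]
      exact ⟨isJoint_tilt P d μ lam ih.1 ih.2, tilt_pos P d μ lam ih.1 ih.2⟩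
  intro t ht
  obtain ⟨hp, hpos⟩ := hjoint t ht
  obtain ⟨hq, hqpos⟩ := hjoint (t + 1) (by omega)
  have htilt : tilt P d μ lam (qseq t) = qseq (t + 1) := (funext₂ (hstep t ht)).symm
  have hpq := Ffun_eq_klJoint_tilt P d μ lam hp hpos hq hqpos
  have hpp := Ffun_eq_klJoint_tilt P d μ lam hp hpos hp hpos
  rw [htilt] at hpp hpq
  rw [klJoint_self, zero_sub] at hpq
  have hkl : 0 ≤ klJoint (qseq t) (qseq (t + 1)) :=
    klJoint_nonneg hp.1 hq.1 (fun x y h => absurd h (hqpos x y).ne') (hq.2.trans hp.2.symm)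
  have hle : Ffun P d μ lam (qseq (t + 1)) (qseq (t + 1)) ≤
      Ffun P d μ lam (qseq t) (qseq (t + 1)) :=
    Ffun_self_le hPpos d hlam0 hlam1 hpos hqpos (hp.2.trans hq.2.symm)
  have hOp := OmegaF_le hP hPpos hd hμ hlam0 hp
  have hOq := OmegaF_le hP hPpos hd hμ hlam0 hq
  rw [← Ffun_self_eq hPpos d μ lam hpos] at hOp
  rw [← Ffun_self_eq hPpos d μ lam hqpos] at hOq
  exact ⟨by linarith, hpq, by linarith, Ffun_self P d μ lam _, hOq, by linarith, hOp⟩
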